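/- arXiv:1311.7629 — 4 statements merged into one kernel-verified Lean document; each statement's English description precedes it below -/
import Mathlib

section
/- Let 1 → F → G →^π Q → 1 be a short exact sequence of groups in which F is finite (equivalently, let π : G → Q be a surjective group homomorphism with finite kernel). Then for every commutative ring R and every integer i ≥ 0 there is an isomorphism of R-modules H^i(G, R[G]) ≅ H^i(Q, R[Q]). -/
open CategoryTheory

section Simplicial

variable {X Y : Type*} (R : Type*) [CommRing R]

/-- The alternating sum of faces, as a coboundary on functions of `n` variables. -/
def faceCoboundary (X : Type*) (n : ℕ) : ((Fin n → X) → R) →ₗ[R] ((Fin (n + 1) → X) → R) where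
  toFun φ x := ∑ p : Fin (n + 1), (-1 : R) ^ (p : ℕ) * φ (x ∘ p.succAbove)
  map_add' φ ψ := by ext x; simp [mul_add, Finset.sum_add_distrib]
  map_smul' r φ := by ext x; simp [Finset.mul_sum, mul_left_comm]

variable {R}

lemma faceCoboundary_apply {n : ℕ} (φ : (Fin n → X) → R) (x : Fin (n + 1) → X) :
    faceCoboundary R X n φ x = ∑ p : Fin (n + 1), (-1 : R) ^ (p : ℕ) * φ (x ∘ p.succAbove) := rfl

lemma faceCoboundary_zero_apply (φ : (Fin 0 → X) → R) (x : Fin 1 → X) :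
    faceCoboundary R X 0 φ x = φ Fin.elim0 := by
  simp [faceCoboundary_apply, Subsingleton.elim _ (Fin.elim0 : Fin 0 → X)]

lemma faceCoboundary_cons {n : ℕ} (φ : (Fin (n + 1) → X) → R) (a : X) (x : Fin (n + 1) → X) :
    faceCoboundary R X (n + 1) φ (Fin.cons a x) =
      φ x - faceCoboundary R X n (fun y => φ (Fin.cons a y)) x := by
  rw [faceCoboundary_apply, Fin.sum_univ_succ, faceCoboundary_apply, sub_eq_add_neg,
    ← Finset.sum_neg_distrib]
  congr 1
  · simp [Fin.succAbove_zero, Function.comp_def]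
  · refine Finset.sum_congr rfl fun p _ => ?_
    have : (Fin.cons a x : Fin (n + 2) → X) ∘ p.succ.succAbove =
        Fin.cons a (x ∘ p.succAbove) := by
      ext i
      cases i using Fin.cases <;> simp
    rw [this, Fin.val_succ, pow_succ]
    ring

lemma faceCoboundary_comp {n : ℕ} (f : X → Y) (φ : (Fin n → Y) → R) (x : Fin (n + 1) → X) :
    faceCoboundary R X n (fun y => φ (f ∘ y)) x = faceCoboundary R Y n φ (f ∘ x) := rfl

lemma faceCoboundary_faceCoboundary (n : ℕ) (φ : (Fin n → X) → R) :
    faceCoboundary R X (n + 1) (faceCoboundary R X n φ) = 0 := by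
  induction n with
  | zero =>
    ext x
    simp [faceCoboundary_apply _ x, faceCoboundary_zero_apply, Fin.sum_univ_two]
  | succ n ih =>
    ext x
    induction x using Fin.consCases with
    | _ a x =>
      rw [faceCoboundary_cons]
      have h : (fun y => faceCoboundary R X (n + 1) φ (Fin.cons a y)) =
          φ - faceCoboundary R X n (fun y => φ (Fin.cons a y)) :=
        funext fun y => faceCoboundary_cons φ a y
      rw [h, map_sub, ih]
      simp

/-- The prism operator: a homotopy from the identity to the pullback along `e : X → X`. -/
def prismOperator (R : Type*) [CommRing R] (e : X → X) :
    ∀ n, ((Fin (n + 1) → X) → R) →ₗ[R] ((Fin n → X) → R)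
  | 0 => 0
  | n + 1 =>
    { toFun φ x := φ (Fin.cons (x 0) (e ∘ x)) -
        prismOperator R e n (fun y => φ (Fin.cons (x 0) y)) (Fin.tail x)
      map_add' φ ψ := by
        ext x
        have := congrFun ((prismOperator R e n).map_add (fun y => φ (Fin.cons (x 0) y))
          (fun y => ψ (Fin.cons (x 0) y))) (Fin.tail x)
        simp only [Pi.add_apply] at this ⊢
        rw [← sub_eq_zero] at this ⊢
        rw [← neg_eq_zero, ← this]
        simp only [Pi.add_def]
        ring
      map_smul' r φ := by
        ext x
        have := congrFun ((prismOperator R e n).map_smul r (fun y => φ (Fin.cons (x 0) y)))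
          (Fin.tail x)
        simp only [Pi.smul_apply, smul_eq_mul, RingHom.id_apply] at this ⊢
        rw [mul_sub, ← this]
        rfl }

lemma prismOperator_cons (e : X → X) {n : ℕ} (φ : (Fin (n + 2) → X) → R) (a : X)
    (x : Fin n → X) :
    prismOperator R e (n + 1) φ (Fin.cons a x) =
      φ (Fin.cons a (Fin.cons (e a) (e ∘ x))) -
        prismOperator R e n (fun y => φ (Fin.cons a y)) x := by
  simp [prismOperator, Fin.comp_cons]

lemma prismOperator_homotopy (e : X → X) (n : ℕ) (φ : (Fin (n + 1) → X) → R)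
    (x : Fin (n + 1) → X) :
    prismOperator R e (n + 1) (faceCoboundary R X (n + 1) φ) x +
      faceCoboundary R X n (prismOperator R e n φ) x = φ (e ∘ x) - φ x := by
  have h {m : ℕ} (φ : (Fin (m + 1) → X) → R) (a : X) :
      (fun y => faceCoboundary R X (m + 1) φ (Fin.cons a y)) =
        φ - faceCoboundary R X m (fun y => φ (Fin.cons a y)) :=
    funext fun y => faceCoboundary_cons φ a y
  induction n with
  | zero =>
    induction x using Fin.consCases with
    | _ a x =>
      rw [prismOperator_cons, faceCoboundary_cons, Fin.comp_cons]
      simp [prismOperator, Subsingleton.elim _ (Fin.elim0 : Fin 0 → X), faceCoboundary_apply]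
  | succ n ih =>
    induction x using Fin.consCases with
    | _ a x =>
      have h' : (fun y => prismOperator R e (n + 1) φ (Fin.cons a y)) =
          (fun y => φ (Fin.cons a (Fin.cons (e a) (e ∘ y)))) -
            prismOperator R e n (fun y => φ (Fin.cons a y)) :=
        funext fun y => prismOperator_cons e φ a y
      rw [prismOperator_cons, h, faceCoboundary_cons φ,
        faceCoboundary_cons (prismOperator _ _ _ _), h', Fin.comp_cons, faceCoboundary_cons,
        map_sub, map_sub, Pi.sub_apply, Pi.sub_apply]
      have := ih (fun y => φ (Fin.cons a y)) x
      have h3 := faceCoboundary_comp e (fun y => φ (Fin.cons a (Fin.cons (e a) y))) x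
      rw [h3]
      linear_combination this

end Simplicial

section FiniteOrbitSupport

/-- The functions on a `G`-set `X` which have finite support along every orbit map `g ↦ g • x`. -/
def finiteOrbitSupport (R G X : Type*) [CommRing R] [Group G] [MulAction G X] :
    Submodule R (X → R) where
  carrier := {φ | ∀ x, {g : G | φ (g • x) ≠ 0}.Finite}
  zero_mem' := by simp
  add_mem' {φ ψ} hφ hψ x := ((hφ x).union (hψ x)).subset fun g hg => by
    by_contra! h
    simp_all
  smul_mem' r φ hφ x := (hφ x).subset fun g hg h => hg (by simp [h])

variable {R G Q : Type*} [CommRing R] [Group G] [Group Q]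

lemma faceCoboundary_mem {n : ℕ} {φ : (Fin n → G) → R}
    (hφ : φ ∈ finiteOrbitSupport R G (Fin n → G)) :
    faceCoboundary R G n φ ∈ finiteOrbitSupport R G (Fin (n + 1) → G) := fun x =>
  (Set.finite_iUnion fun p : Fin (n + 1) => hφ (x ∘ p.succAbove)).subset fun g hg => by
    by_contra! h
    simp only [Set.mem_iUnion, Set.mem_ofPred_eq, not_exists, not_not] at h
    exact hg ((faceCoboundary_apply _ _).trans <|
      Finset.sum_eq_zero fun p _ => mul_eq_zero_of_right _ (h p))

lemma finite_ne_zero_of_forall_mem {ι X : Type*} [MulAction G X] {γ : ι → G}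
    {ψ : ι → X → R} {T : Set X} (hT : T.Finite) {t : ι → X}
    (ht : ∀ i, (γ i)⁻¹ • t i ∈ T) (hψ : ∀ y ∈ T, {i | ψ i (γ i • y) ≠ 0}.Finite) :
    {i | ψ i (t i) ≠ 0}.Finite :=
  (hT.biUnion hψ).subset fun i hi => Set.mem_biUnion (ht i) (by simpa using hi)

variable {π : G →* Q} {s : Q → G}

lemma finite_preimage_singleton (hker : Finite π.ker) (q : Q) : (π ⁻¹' {q}).Finite := by
  by_cases h : ∃ g, π g = q
  · obtain ⟨g, rfl⟩ := h
    refine ((Set.toFinite (π.ker : Set G)).image (g * ·)).subset fun x hx => ?_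
    refine ⟨g⁻¹ * x, ?_, by simp⟩
    simpa [MonoidHom.mem_ker, inv_mul_eq_one, eq_comm (a := π g)] using hx
  · convert Set.finite_empty
    ext g
    simpa using fun hg => h ⟨g, hg⟩

lemma finite_pi_preimage_singleton (hker : Finite π.ker) {n : ℕ} (x : Fin n → Q) :
    {y : Fin n → G | π ∘ y = x}.Finite := by
  refine (Set.Finite.pi' fun i => finite_preimage_singleton hker (x i)).subset ?_
  rintro y rfl i
  simp

lemma comp_hom_mem (hker : Finite π.ker) {n : ℕ} {φ : (Fin n → Q) → R}
    (hφ : φ ∈ finiteOrbitSupport R Q (Fin n → Q)) :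
    (fun x => φ (π ∘ x)) ∈ finiteOrbitSupport R G (Fin n → G) := fun x => by
  have h (g : G) : π ∘ (g • x) = π g • (π ∘ x) := by ext; simp
  simp only [h]
  exact (hφ (π ∘ x)).preimage' fun q _ => finite_preimage_singleton hker q

lemma comp_section_mem (hker : Finite π.ker) (hs : Function.RightInverse s π) {n : ℕ}
    {φ : (Fin n → G) → R} (hφ : φ ∈ finiteOrbitSupport R G (Fin n → G)) :
    (fun x => φ (s ∘ x)) ∈ finiteOrbitSupport R Q (Fin n → Q) := fun x =>
  finite_ne_zero_of_forall_mem (γ := s) (ψ := fun _ => φ)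
    (finite_pi_preimage_singleton hker x) (fun q => by ext; simp [hs _])
    fun y _ => (hφ y).preimage hs.injective.injOn

lemma finite_prismOperator_ne_zero (hker : Finite π.ker) {e : G → G} (he : ∀ g, π (e g) = π g)
    {n : ℕ} (φ : G → (Fin (n + 1) → G) → R) (hφ : ∀ x, {g | φ g (g • x) ≠ 0}.Finite)
    (x : Fin n → G) : {g | prismOperator R e n (φ g) (g • x) ≠ 0}.Finite := by
  induction n with
  | zero => simp [prismOperator]
  | succ n ih =>
    induction x using Fin.consCases with
    | _ a x =>
      have smul_cons {m : ℕ} (g b : G) (y : Fin m → G) :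
          g • (Fin.cons b y : Fin (m + 1) → G) = Fin.cons (g * b) (g • y) := by
        ext i
        cases i using Fin.cases <;> simp
      have h₁ : {g | φ g (Fin.cons (g * a) (e ∘ (g • (Fin.cons a x : Fin (n + 1) → G))))
          ≠ 0}.Finite :=
        finite_ne_zero_of_forall_mem (γ := id)
          (ψ := fun g y => φ g (Fin.cons (g * a) y))
          (finite_pi_preimage_singleton hker (π ∘ (Fin.cons a x : Fin (n + 1) → G)))
          (fun g => by ext; simp [he]) fun y _ => by
            simpa only [smul_cons, id] using hφ (Fin.cons a y)
      have h₂ := ih (fun g y => φ g (Fin.cons (g * a) y))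
        (fun y => by simpa only [smul_cons] using hφ (Fin.cons a y)) x
      refine (h₁.union h₂).subset fun g hg => ?_
      by_contra! h
      simp only [Set.mem_union, Set.mem_ofPred_eq, not_or, not_not] at h
      refine hg ?_
      rw [smul_cons, prismOperator_cons, h.2, sub_zero, ← Fin.comp_cons, ← smul_cons, h.1]

lemma prismOperator_mem (hker : Finite π.ker) {e : G → G} (he : ∀ g, π (e g) = π g)
    {n : ℕ} {φ : (Fin (n + 1) → G) → R} (hφ : φ ∈ finiteOrbitSupport R G (Fin (n + 1) → G)) :
    prismOperator R e n φ ∈ finiteOrbitSupport R G (Fin n → G) :=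
  finite_prismOperator_ne_zero hker he (fun _ => φ) hφ

end FiniteOrbitSupport

section Complex

universe u

open MonoidAlgebra

variable (R G Q : Type u) [CommRing R] [Group G] [Group Q]

/-- The complex of homogeneous cochains with finite support along orbits. -/
noncomputable def finiteOrbitSupportComplex : CochainComplex (ModuleCat.{u} R) ℕ :=
  CochainComplex.of (fun n => ModuleCat.of R (finiteOrbitSupport R G (Fin (n + 1) → G)))
    (fun n => ModuleCat.ofHom ((faceCoboundary R G (n + 1)).restrict
      fun _ => faceCoboundary_mem))
    fun n => ModuleCat.hom_ext <| LinearMap.ext fun φ =>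
      Subtype.ext (faceCoboundary_faceCoboundary (n + 1) φ.1)

variable {R G} in
lemma coeff_hom_smul_single {X : Type u} [MulAction G X]
    (f : Rep.ofMulAction R G X ⟶ Rep.ofMulAction R G G) (g : G) (x : X) :
    (f.hom (single (g • x) 1)).coeff 1 = (f.hom (single x 1)).coeff g⁻¹ := by
  have := Rep.hom_comm_apply f g (single x 1)
  rw [Representation.ofMulAction_single] at this
  rw [this, Representation.coeff_ofMulAction]
  simp

variable {G} in
/-- Equivariant maps `R[X] ⟶ R[G]` are the functions on `X` with finite support along orbits. -/
noncomputable def ofMulActionHomToFun (X : Type u) [MulAction G X] :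
    (Rep.ofMulAction R G X ⟶ Rep.ofMulAction R G G) →ₗ[R] finiteOrbitSupport R G X where
  toFun f := ⟨fun x => (f.hom (single x 1)).coeff 1, fun x => by
    have h (g : G) : (f.hom (single (g • x) 1)).coeff 1 = (f.hom (single x 1)).coeff g⁻¹ :=
      coeff_hom_smul_single f g x
    simp only [h]
    exact ((f.hom (single x 1)).coeff.hasFiniteSupport).preimage inv_injective.injOn⟩
  map_add' f g := rfl
  map_smul' r f := rfl

variable {R G} in
lemma finiteOrbitSupportComplex_d (i : ℕ) : (finiteOrbitSupportComplex R G).d i (i + 1) =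
    ModuleCat.ofHom ((faceCoboundary R G (i + 1)).restrict fun _ => faceCoboundary_mem) := by
  simp [finiteOrbitSupportComplex]

variable {R G} in
lemma ofMulActionHomToFun_apply {X : Type u} [MulAction G X]
    (f : Rep.ofMulAction R G X ⟶ Rep.ofMulAction R G G) (x : X) :
    (ofMulActionHomToFun R X f).1 x = (f.hom (single x 1)).coeff 1 := rfl

lemma ofMulActionHomToFun_bijective (X : Type u) [MulAction G X] :
    Function.Bijective (ofMulActionHomToFun (G := G) R X) := by
  refine ⟨fun f f' h => ?_, fun φ => ?_⟩
  · refine Rep.hom_ext <| Representation.IntertwiningMap.toLinearMap_injective _ _ <|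
      MonoidAlgebra.lhom_ext' fun x => LinearMap.ext_ring ?_
    ext g
    have := congrFun (congrArg Subtype.val h) (g⁻¹ • x)
    rw [ofMulActionHomToFun_apply, ofMulActionHomToFun_apply, coeff_hom_smul_single,
      coeff_hom_smul_single, inv_inv] at this
    exact this
  · let c (x : X) : R[G] := (coeffLinearEquiv R).symm <|
      Finsupp.ofSupportFinite (fun g => φ.1 (g⁻¹ • x)) <|
        (φ.2 x).preimage inv_injective.injOn
    have hc (x : X) (g : G) : (c x).coeff g = φ.1 (g⁻¹ • x) := rfl
    let l : R[X] →ₗ[R] R[G] := Finsupp.linearCombination R c ∘ₗ (coeffLinearEquiv R).toLinearMap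
    have hl (x : X) : l (single x 1) = c x := by simp [l]
    refine ⟨Rep.ofHom ⟨l, fun g => MonoidAlgebra.lhom_ext' fun x => LinearMap.ext_ring ?_⟩, ?_⟩
    · ext h
      simp only [LinearMap.comp_apply, lsingle_apply, Representation.ofMulAction_single, hl,
        Representation.coeff_ofMulAction, hc]
      simp [mul_smul]
    · refine Subtype.ext (funext fun x => ?_)
      refine (congrArg (fun a : R[G] => a.coeff 1) (hl x)).trans ?_
      simp [hc]

variable {R G} in
lemma map_standardComplex_d_single {n : ℕ} (L : R[Fin n → G] →ₗ[R] R) (x : Fin (n + 1) → G) :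
    L (Rep.standardComplex.d R G n (single x 1)) =
      faceCoboundary R G n (fun y => L (single y 1)) x := by
  rw [Rep.standardComplex.d_of, map_sum, faceCoboundary_apply]
  refine Finset.sum_congr rfl fun p _ => ?_
  rw [← smul_eq_mul, ← map_smul, smul_single, smul_eq_mul, mul_one]

/-- Equivariant cochains on the standard resolution with values in `R[G]`, as functions. -/
noncomputable def linearYonedaObjStandardComplexIso :
    (Rep.standardComplex R G).linearYonedaObj R (Rep.ofMulAction R G G) ≅
      finiteOrbitSupportComplex R G :=
  HomologicalComplex.Hom.isoOfComponents
    (fun n => (LinearEquiv.ofBijective (ofMulActionHomToFun R (Fin (n + 1) → G))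
      (ofMulActionHomToFun_bijective R G _)).toModuleIso) (by
    rintro i j (rfl : i + 1 = j)
    refine ModuleCat.hom_ext <| LinearMap.ext fun f => Subtype.ext <| funext fun x => ?_
    rw [finiteOrbitSupportComplex_d]
    let L : R[Fin (i + 1) → G] →ₗ[R] R :=
      Finsupp.lapply 1 ∘ₗ (coeffLinearEquiv R).toLinearMap ∘ₗ f.hom.toLinearMap
    exact (map_standardComplex_d_single L x).symm.trans
      (congrArg L (Rep.standardComplex.d_apply R G (single x 1))).symm)

variable {R G Q}

/-- Pullback of cochains along a map of groups that preserves finiteness of orbit supports. -/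
noncomputable def finiteOrbitSupportComplexMap (f : G → Q)
    (hf : ∀ n (φ : (Fin n → Q) → R), φ ∈ finiteOrbitSupport R Q (Fin n → Q) →
      (fun x : Fin n → G => φ (f ∘ x)) ∈ finiteOrbitSupport R G (Fin n → G)) :
    finiteOrbitSupportComplex R Q ⟶ finiteOrbitSupportComplex R G where
  f n := ModuleCat.ofHom ((LinearMap.funLeft R R (f ∘ · : (Fin (n + 1) → G) → _)).restrict (hf _))
  comm' := by
    rintro i j (rfl : i + 1 = j)
    rw [finiteOrbitSupportComplex_d, finiteOrbitSupportComplex_d]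
    rfl

/-- The prism operators give a homotopy from the identity to the pullback along a self-map `e` of
`G` which preserves the fibres of a homomorphism with finite kernel. -/
noncomputable def prismHomotopy {π : G →* Q} (hker : Finite π.ker) {e : G → G}
    (he : ∀ g, π (e g) = π g) (φ : finiteOrbitSupportComplex R G ⟶ finiteOrbitSupportComplex R G)
    (hφ : ∀ n (c : finiteOrbitSupport R G (Fin (n + 1) → G)) x, (φ.f n c).1 x = c.1 (e ∘ x)) :
    Homotopy φ (𝟙 _) := by
  let h : ∀ i j, (ComplexShape.up ℕ).Rel j i →
      ((finiteOrbitSupportComplex R G).X i ⟶ (finiteOrbitSupportComplex R G).X j) :=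
    fun i j hij => by
      subst hij
      exact ModuleCat.ofHom ((prismOperator R e (j + 1)).restrict
        fun _ => prismOperator_mem hker he)
  refine Homotopy.equivSubZero.symm ((Homotopy.ofEq ?_).trans (Homotopy.nullHomotopy' h))
  ext n c
  refine Subtype.ext <| funext fun x => (?_ : (φ.f n c).1 x - c.1 x = _)
  refine (congrArg (· - c.1 x) (hφ n c x)).trans ((prismOperator_homotopy e n c.1 x).symm.trans ?_)
  obtain _ | n := n
  · rw [Homotopy.nullHomotopicMap'_f_of_not_rel_right (k₁ := 0) (k₀ := 1) rfl (by simp),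
      finiteOrbitSupportComplex_d]
    refine (congrArg (_ + ·) (congrFun (map_zero (faceCoboundary R G 0)) x)).trans ?_
    exact add_zero _
  · rw [Homotopy.nullHomotopicMap'_f (k₂ := n) (k₁ := n + 1) (k₀ := n + 2) rfl rfl,
      finiteOrbitSupportComplex_d, finiteOrbitSupportComplex_d]
    rfl

/-- A surjection with finite kernel induces a homotopy equivalence on cochains with finite support
along orbits. -/
noncomputable def finiteOrbitSupportComplexEquiv {π : G →* Q} (hker : Finite π.ker) {s : Q → G}
    (hs : Function.RightInverse s π) :
    HomotopyEquiv (finiteOrbitSupportComplex R G) (finiteOrbitSupportComplex R Q) where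
  hom := finiteOrbitSupportComplexMap s fun _ _ => comp_section_mem hker hs
  inv := finiteOrbitSupportComplexMap π fun _ _ => comp_hom_mem hker
  homotopyHomInvId := prismHomotopy (e := s ∘ π) hker (fun g => hs (π g)) _ fun _ _ _ => rfl
  homotopyInvHomId := Homotopy.ofEq <| by
    ext n c
    refine Subtype.ext <| funext fun x => congrArg c.1 (?_ : π ∘ s ∘ x = x)
    exact funext fun i => hs (x i)

variable (R G) in
/-- The cohomology of `G` with coefficients in `R[G]` is computed by the cochains with finite
support along orbits. -/
noncomputable def groupCohomologyRegularIso (i : ℕ) :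
    groupCohomology (Rep.ofMulAction R G G) i ≅ (finiteOrbitSupportComplex R G).homology i :=
  groupCohomologyIso _ i (Rep.standardResolution R G) ≪≫
    (HomologicalComplex.homologyFunctor _ _ i).mapIso (linearYonedaObjStandardComplexIso R G)

end Complex

/-- If `1 → F → G → Q → 1` is a short exact sequence of groups with `F`
finite (i.e. `π : G → Q` is surjective with finite kernel), then for every commutative ring
`R` and every `i ≥ 0` there is an isomorphism of `R`-modules
`H^i(G, R[G]) ≅ H^i(Q, R[Q])`, where `R[G]` is the left regular representation. -/
theorem finite_kernel_quotient_groupCohomology_regular_iso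
    {G Q : Type} [Group G] [Group Q] (π : G →* Q)
    (hsurj : Function.Surjective π) (hker : Finite π.ker)
    (R : Type) [CommRing R] (i : ℕ) :
    Nonempty ((groupCohomology (Rep.ofMulAction R G G) i) ≃ₗ[R]
      (groupCohomology (Rep.ofMulAction R Q Q) i)) := by
  obtain ⟨s, hs⟩ := hsurj.hasRightInverse
  exact ⟨(groupCohomologyRegularIso R G i ≪≫
    (finiteOrbitSupportComplexEquiv hker hs).toHomologyIso i ≪≫
    (groupCohomologyRegularIso R Q i).symm).toLinearEquiv⟩
end

section
/- Let π : G → Q be a surjective group homomorphism with finite kernel. If Q has finitely many conjugacy classes of finite subgroups, then G has finitely many conjugacy classes of finite subgroups. -/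
/-- A group has finitely many conjugacy classes of finite subgroups if there is a finite set
of (finite) subgroups such that every finite subgroup is conjugate to one of them. -/
def HasFinitelyManyConjClassesOfFiniteSubgroups (G : Type) [Group G] : Prop :=
  ∃ S : Finset (Subgroup G), (∀ K ∈ S, Finite K) ∧
    ∀ K : Subgroup G, Finite K →
      ∃ K' ∈ S, ∃ g : G, K.map (MulAut.conj g).toMonoidHom = K'

/-- The preimage of a finite subgroup under a homomorphism with finite kernel is finite. -/
theorem Subgroup.finite_coe_comap_of_finite_ker {G Q : Type*} [Group G] [Group Q] (π : G →* Q)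
    (hker : Finite π.ker) (K : Subgroup Q) (hK : Finite K) :
    (K.comap π : Set G).Finite := by
  rw [Subgroup.coe_comap]
  refine Set.Finite.preimage' (Set.toFinite (K : Set Q)) fun b _ => ?_
  rcases (π ⁻¹' {b}).eq_empty_or_nonempty with h | ⟨g, hg⟩
  · rw [h]
    exact Set.finite_empty
  · refine ((Set.toFinite (π.ker : Set G)).image (g * ·)).subset fun x hx => ?_
    refine ⟨g⁻¹ * x, ?_, mul_inv_cancel_left g x⟩
    have hg' : π g = b := hg
    have hx' : π x = b := hx
    simp [MonoidHom.mem_ker, hg', hx']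

/-- If `π : G → Q` is a surjective group homomorphism with finite kernel and
`Q` has finitely many conjugacy classes of finite subgroups, then so does `G`. -/
theorem hasFinitelyManyConjClassesOfFiniteSubgroups_of_surjective_finite_ker
    {G Q : Type} [Group G] [Group Q] (π : G →* Q)
    (hsurj : Function.Surjective π) (hker : Finite π.ker)
    (hQ : HasFinitelyManyConjClassesOfFiniteSubgroups Q) :
    HasFinitelyManyConjClassesOfFiniteSubgroups G := by
  obtain ⟨S, hS, hconj⟩ := hQ
  have hcomap (K : Subgroup Q) (hK : K ∈ S) : (K.comap π : Set G).Finite :=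
    Subgroup.finite_coe_comap_of_finite_ker π hker K (hS K hK)
  have hT : {H : Subgroup G | ∃ K ∈ S, H ≤ K.comap π}.Finite := by
    have hU : (⋃ K ∈ S, {H : Subgroup G | H ≤ K.comap π}).Finite :=
      S.finite_toSet.biUnion fun K hK =>
        Set.Finite.of_finite_image ((hcomap K hK).finite_subsets.subset
          (Set.image_subset_iff.2 fun H hH => SetLike.coe_subset_coe.2 hH))
          SetLike.coe_injective.injOn
    exact hU.subset fun H ⟨K, hK, hH⟩ => Set.mem_biUnion hK hH
  refine ⟨hT.toFinset, fun H hH => ?_, fun H hH => ?_⟩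
  · obtain ⟨K, hK, hle⟩ := hT.mem_toFinset.1 hH
    exact ((hcomap K hK).subset hle).to_subtype
  · obtain ⟨K, hK, q, hq⟩ := hconj (H.map π) ((Set.toFinite (H : Set G)).image π).to_subtype
    obtain ⟨g, rfl⟩ := hsurj q
    refine ⟨_, hT.mem_toFinset.2 ⟨K, hK, ?_⟩, g, rfl⟩
    rintro _ ⟨x, hx, rfl⟩
    rw [Subgroup.mem_comap, ← hq]
    exact ⟨π x, Subgroup.mem_map_of_mem π hx, by simp⟩
end

section
/- Let G be a group such that for every prime p the first group cohomology H¹(G, 𝔽ₚ[G]) of G with coefficients in the left regular representation over the field 𝔽ₚ with p elements vanishes. Then H²(G, ℤ[G]), the second group cohomology of G with coefficients in the left regular representation over ℤ, is a torsion-free abelian group. -/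
open groupCohomology in
/-- Let `π : A → B` be a surjective equivariant map with kernel `nA`, where `A` is `n`-torsion-free.
If `H¹(G, B)` vanishes, then `H²(G, A)` is `n`-torsion-free. -/
theorem groupCohomology_two_eq_zero_of_smul_eq_zero
    {k G : Type} [CommRing k] [Group G] {A : Rep ℤ G} {B : Rep k G} {n : ℤ} (π : A.V →+ B.V)
    (equivariant : ∀ g a, π (A.ρ g a) = B.ρ g (π a)) (surjective : Function.Surjective π)
    (ker : ∀ a, π a = 0 ↔ ∃ b, a = n • b) (inj : ∀ a b : A.V, n • a = n • b → a = b)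
    (vanish : Subsingleton (groupCohomology B 1))
    (x : groupCohomology A 2) (hx : n • x = 0) : x = 0 := by
  induction x using H2_induction_on with | h f
  rw [H2π_eq_zero_iff]
  rw [← map_zsmul, H2π_eq_zero_iff] at hx
  obtain ⟨c, hc⟩ := hx
  replace hc (g h : G) : A.ρ g (c h) - c (g * h) + c g = n • f (g, h) := congrFun hc (g, h)
  have cocycle : (fun g ↦ π (c g)) ∈ cocycles₁ B := by
    rw [mem_cocycles₁_def]
    intro g h
    rw [← equivariant, ← map_sub, ← map_add, ker]
    exact ⟨_, hc g h⟩
  obtain ⟨m', hm'⟩ := (H1π_eq_zero_iff ⟨_, cocycle⟩).1 (vanish.elim _ _)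
  obtain ⟨m, rfl⟩ := surjective m'
  replace hm' (g : G) : B.ρ g (π m) - π m = π (c g) := congrFun hm' g
  have lift (g : G) : ∃ e, c g - (A.ρ g m - m) = n • e := by
    rw [← ker, map_sub, map_sub, equivariant, hm', sub_self]
  choose e he using lift
  refine ⟨e, funext fun ⟨g, h⟩ ↦ inj _ _ ?_⟩
  change n • (A.ρ g (e h) - e (g * h) + e g) = n • f (g, h)
  have ρ_mul : A.ρ (g * h) m = A.ρ g (A.ρ h m) := by
    rw [A.ρ.map_mul]
    rfl
  have ρ_zsmul : n • A.ρ g (e h) = A.ρ g (n • e h) :=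
    ((A.ρ g).toAddMonoidHom.map_zsmul _ _).symm
  rw [← hc, zsmul_add, zsmul_sub, ρ_zsmul, ← he, ← he, ← he, ρ_mul]
  simp only [map_sub]
  abel

/-- If `G` is a group such that for every prime `p` the first group
cohomology `H¹(G, 𝔽ₚ[G])` with coefficients in the left regular representation over
`𝔽ₚ = ZMod p` vanishes, then `H²(G, ℤ[G])` is a torsion-free abelian group. -/
theorem groupCohomology_two_regular_torsionFree_of_H1_vanishes
    {G : Type} [Group G]
    (h : ∀ p : ℕ, p.Prime →
      Subsingleton (groupCohomology (Rep.ofMulAction (ZMod p) G G) 1)) :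
    ∀ (x : groupCohomology (Rep.ofMulAction ℤ G G) 2) (n : ℤ),
      n ≠ 0 → n • x = 0 → x = 0 := by
  have prime_torsion (p : ℕ) (hp : p.Prime) (x : groupCohomology (Rep.ofMulAction ℤ G G) 2)
      (hx : (p : ℤ) • x = 0) : x = 0 := by
    have p_ne_zero : (p : ℤ) ≠ 0 := by exact_mod_cast hp.ne_zero
    refine groupCohomology_two_eq_zero_of_smul_eq_zero (n := p)
      (MonoidAlgebra.mapRingHom G (Int.castRingHom (ZMod p))).toAddMonoidHom
      ?_ ?_ ?_ ?_ (h p hp) x hx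
    · intro g a
      ext j
      change (MonoidAlgebra.mapRingHom G _ (Representation.ofMulAction ℤ G G g a)).coeff j =
        (Representation.ofMulAction (ZMod p) G G g (MonoidAlgebra.mapRingHom G _ a)).coeff j
      simp [Representation.coeff_ofMulAction]
    · exact MonoidAlgebra.map_surjective (Int.castRingHom (ZMod p)).toAddMonoidHom
        (ZMod.ringHom_surjective (Int.castRingHom (ZMod p)))
    · intro a
      change MonoidAlgebra.mapRingHom G (Int.castRingHom (ZMod p)) a = 0 ↔
        ∃ b : MonoidAlgebra ℤ G, a = (p : ℤ) • b
      constructor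
      · intro ha
        have dvd (j : G) : (p : ℤ) ∣ a.coeff j := by
          rw [← ZMod.intCast_zmod_eq_zero_iff_dvd]
          simpa using congrArg (fun b ↦ b.coeff j) ha
        refine ⟨.ofCoeff (a.coeff.mapRange (· / (p : ℤ)) (Int.zero_ediv _)), ?_⟩
        ext j
        exact (Int.mul_ediv_cancel' (dvd j)).symm
      · rintro ⟨b, rfl⟩
        rw [map_zsmul]
        ext j
        change (p : ℤ) • ((MonoidAlgebra.mapRingHom G (Int.castRingHom (ZMod p)) b).coeff j) = 0
        simp
    · intro a b hab
      ext j
      exact mul_left_cancel₀ p_ne_zero (congrArg (fun c ↦ c.coeff j) hab)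
  have nat_torsion (n : ℕ) : ∀ x : groupCohomology (Rep.ofMulAction ℤ G G) 2,
      n ≠ 0 → (n : ℤ) • x = 0 → x = 0 := by
    induction n using induction_on_primes with
    | zero => exact fun _ hn ↦ absurd rfl hn
    | one => exact fun x _ hx ↦ by simpa using hx
    | prime_mul p n hp ih =>
      intro x hn hx
      refine ih x (right_ne_zero_of_mul hn) (prime_torsion p hp _ ?_)
      rwa [smul_smul, ← Nat.cast_mul]
  intro x n hn hx
  refine nat_torsion n.natAbs x (Int.natAbs_ne_zero.2 hn) ?_
  rcases Int.natAbs_eq n with hn | hn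
  · rwa [← hn]
  · rw [hn, neg_zsmul, neg_eq_zero] at hx
    exact hx
end

section
/- Let p be a prime and let φ be an automorphism of the Baumslag–Solitar group BS(1,p) = ⟨x, y ∣ y⁻¹xy = xᵖ⟩ satisfying φ(x) = x⁻¹ and φ(y) = y. Then the fixed subgroup {g ∈ BS(1,p) : φ(g) = g} is exactly the cyclic subgroup ⟨y⟩ generated by y. -/
/-- The single relator `y⁻¹ * x * y * x⁻ᵖ` of the Baumslag–Solitar group `BS(1,p)`, where
`x = FreeGroup.of 0` and `y = FreeGroup.of 1`. -/
def BSRel (p : ℕ) : Set (FreeGroup (Fin 2)) :=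
  {(FreeGroup.of 1)⁻¹ * FreeGroup.of 0 * FreeGroup.of 1 * ((FreeGroup.of 0) ^ p)⁻¹}

/-- The Baumslag–Solitar group `BS(1,p) = ⟨x, y ∣ y⁻¹xy = xᵖ⟩` as a presented group. -/
abbrev BaumslagSolitar (p : ℕ) := PresentedGroup (BSRel p)

/-- If `y⁻¹ x y = xᵖ`, then `xᵏ yⁱ = yⁱ x^(k pⁱ)`. -/
theorem zpow_mul_pow_of_conj_eq_pow {G : Type*} [Group G] {x y : G} {p : ℕ}
    (h : y⁻¹ * x * y = x ^ p) (k : ℤ) (i : ℕ) :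
    x ^ k * y ^ i = y ^ i * x ^ (k * (p : ℤ) ^ i) := by
  have hk (m : ℤ) : x ^ m * y = y * x ^ (m * p) := by
    have := conj_zpow (a := y⁻¹) (b := x) (i := m)
    rw [inv_inv, h, ← zpow_natCast, ← zpow_mul, mul_comm (p : ℤ)] at this
    rw [this]
    group
  induction i with
  | zero => simp
  | succ i ih => rw [pow_succ, ← mul_assoc, ih, mul_assoc, hk, mul_assoc, pow_succ, mul_assoc]

namespace BaumslagSolitar

theorem conj_of_eq_pow (p : ℕ) :
    (PresentedGroup.of 1 : BaumslagSolitar p)⁻¹ * PresentedGroup.of 0 * PresentedGroup.of 1 =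
      PresentedGroup.of 0 ^ p :=
  mul_inv_eq_one.mp (PresentedGroup.one_of_mem (rels := BSRel p) rfl)

theorem exists_eq_pow_mul_zpow_mul_zpow {p : ℕ} (g : BaumslagSolitar p) :
    ∃ (i : ℕ) (k j : ℤ),
      g = PresentedGroup.of 1 ^ i * PresentedGroup.of 0 ^ k * PresentedGroup.of 1 ^ j := by
  have hg : g ∈ Subgroup.closure (Set.range (PresentedGroup.of (rels := BSRel p))) := by
    simp [PresentedGroup.closure_range_of]
  have key := zpow_mul_pow_of_conj_eq_pow (conj_of_eq_pow p)
  generalize hX : (PresentedGroup.of 0 : BaumslagSolitar p) = x at *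
  generalize hY : (PresentedGroup.of 1 : BaumslagSolitar p) = y at *
  have left_zpow (m : ℤ) (i : ℕ) (k j : ℤ) :
      x ^ m * (y ^ i * x ^ k * y ^ j) = y ^ i * x ^ (m * (p : ℤ) ^ i + k) * y ^ j := by
    rw [← mul_assoc, ← mul_assoc, key, zpow_add, mul_assoc (y ^ i)]
  induction hg using Subgroup.closure_induction_left with
  | one => exact ⟨0, 0, 0, by simp⟩
  | mul_left a ha b _ ih =>
    obtain ⟨n, rfl⟩ := ha
    obtain ⟨i, k, j, rfl⟩ := ih
    fin_cases n
    · exact ⟨i, _, j, by simpa [hX] using left_zpow 1 i k j⟩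
    · exact ⟨i + 1, k, j, by simp [hY, pow_succ', mul_assoc]⟩
  | inv_mul_cancel a ha b _ ih =>
    obtain ⟨n, rfl⟩ := ha
    obtain ⟨i, k, j, rfl⟩ := ih
    fin_cases n
    · exact ⟨i, _, j, by simpa [hX] using left_zpow (-1) i k j⟩
    · cases i with
      | zero =>
        refine ⟨0, k * p, j - 1, ?_⟩
        have := key k 1
        simp only [pow_one] at this
        simp only [Fin.mk_one, hY, pow_zero, one_mul]
        rw [inv_mul_eq_iff_eq_mul, ← mul_assoc, ← this, mul_assoc, ← zpow_one_add]
        simp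
      | succ i => exact ⟨i, k, j, by simp [hY, pow_succ', mul_assoc]⟩

/-- The action of `BS(1,p)` on `ℚ` in which `x` translates by `1` and `y` divides by `p`. -/
noncomputable def toPerm (p : ℕ) (hp : (p : ℚ) ≠ 0) : BaumslagSolitar p →* Equiv.Perm ℚ :=
  PresentedGroup.toGroup (f := ![Equiv.addRight 1, (Equiv.mulRight₀ (p : ℚ) hp)⁻¹]) (by
    rintro r rfl
    ext t
    simp [hp, Equiv.Perm.mul_apply, add_mul])

theorem of_zero_zpow_eq_one_iff {p : ℕ} (hp : p ≠ 0) {k : ℤ} :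
    (PresentedGroup.of 0 : BaumslagSolitar p) ^ k = 1 ↔ k = 0 := by
  refine ⟨fun h => ?_, fun h => by simp [h]⟩
  have := congrArg (fun g => toPerm p (Nat.cast_ne_zero.mpr hp) g 0) h
  simpa [toPerm] using this

end BaumslagSolitar

/-- Let `p` be a prime and `φ` an automorphism of
`BS(1,p) = ⟨x, y ∣ y⁻¹xy = xᵖ⟩` with `φ(x) = x⁻¹` and `φ(y) = y`. Then the fixed subgroup
`{g : φ(g) = g}` is exactly the cyclic subgroup generated by `y`. -/
theorem fixed_points_of_BS_automorphism (p : ℕ) (hp : p.Prime)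
    (φ : BaumslagSolitar p ≃* BaumslagSolitar p)
    (hx : φ (PresentedGroup.of 0) = (PresentedGroup.of 0)⁻¹)
    (hy : φ (PresentedGroup.of 1) = PresentedGroup.of 1) :
    ∀ g : BaumslagSolitar p,
      φ g = g ↔ g ∈ Subgroup.zpowers (PresentedGroup.of 1) := by
  intro g
  constructor
  · intro h
    obtain ⟨i, k, j, rfl⟩ := BaumslagSolitar.exists_eq_pow_mul_zpow_mul_zpow g
    simp only [map_mul, map_pow, map_zpow, hx, hy, mul_left_inj, mul_right_inj] at h
    rw [inv_zpow', ← mul_inv_eq_one, ← zpow_neg, ← zpow_add,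
      BaumslagSolitar.of_zero_zpow_eq_one_iff hp.ne_zero] at h
    obtain rfl : k = 0 := by omega
    exact ⟨i + j, by simp [zpow_add]⟩
  · rintro ⟨n, rfl⟩
    simp [hy]
end
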